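/- arXiv:2109.11575 — 2 statements merged into one kernel-verified Lean document; each statement's English description precedes it below -/
import Mathlib

section
/- Let W₂ = {(p₁,p₂) ∈ S^m × S^m : p₁ ≠ ±p₂}, with ℤ/2 acting diagonally by the antipodal map: τ·(p₁,p₂) = (-p₁,-p₂). If m is odd and m ≥ 2, then there is no continuous ℤ/2-equivariant map from W₂ to S^(d-1) for any d ≤ m, where ℤ/2 acts antipodally on S^(d-1). -/
namespace BU

/-- Mod 2 ordered chains: formal sums of finite lists of points. -/
abbrev Ch (E : Type*) := List E →₀ ZMod 2

noncomputable section

variable {E : Type*}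

/-- The basis chain of a list. -/
def s (l : List E) : Ch E := Finsupp.single l 1

/-- Linear extension. -/
def lin {M : Type*} [AddCommGroup M] [Module (ZMod 2) M] (f : List E → M) : Ch E →ₗ[ZMod 2] M :=
  Finsupp.linearCombination (ZMod 2) f

@[simp] lemma lin_s {M : Type*} [AddCommGroup M] [Module (ZMod 2) M] (f : List E → M)
    (l : List E) : lin f (s l) = f l := by
  simp [lin, s]

lemma ch_ext {M : Type*} [AddCommGroup M] [Module (ZMod 2) M] {f g : Ch E →ₗ[ZMod 2] M}
    (h : ∀ l, f (s l) = g (s l)) : f = g :=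
  Finsupp.lhom_ext' fun l => LinearMap.ext_ring (h l)

lemma two_ch {M : Type*} [AddCommGroup M] [Module (ZMod 2) M] (c : M) : c + c = 0 := by
  have : (2 : ZMod 2) • c = 0 := by
    have : (2 : ZMod 2) = 0 := by decide
    rw [this, zero_smul]
  rwa [two_smul] at this

/-- Cone. -/
def cone (v : E) : Ch E →ₗ[ZMod 2] Ch E := lin fun l => s (v :: l)

@[simp] lemma cone_s (v : E) (l : List E) : cone v (s l) = s (v :: l) := by simp [cone]

/-- Boundary of a list. -/
def bdl : List E → Ch E
  | [] => 0
  | v :: l => s l + cone v (bdl l)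

/-- Boundary. -/
def bd : Ch E →ₗ[ZMod 2] Ch E := lin bdl

@[simp] lemma bd_s (l : List E) : bd (s l) = bdl l := by simp [bd]

lemma bd_cone (v : E) (c : Ch E) : bd (cone v c) = c + cone v (bd c) := by
  have : bd ∘ₗ cone v = LinearMap.id + cone v ∘ₗ (bd (E := E)) := by
    apply ch_ext; intro l; simp [bdl]
  exact LinearMap.congr_fun this c

lemma bd_bdl (l : List E) : bd (bdl l) = 0 := by
  induction l with
  | nil => simp [bdl]
  | cons v l ih =>
    simp only [bdl, map_add, bd_s, bd_cone, ih, map_zero, add_zero]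
    exact two_ch _

/-- Chains supported on lists satisfying a predicate. -/
def Sup (P : List E → Prop) : Submodule (ZMod 2) (Ch E) := Submodule.span _ (s '' {l | P l})

lemma s_mem {P : List E → Prop} {l : List E} (h : P l) : s l ∈ Sup P :=
  Submodule.subset_span ⟨l, h, rfl⟩

lemma map_mem {P : List E → Prop} {M : Type*} [AddCommGroup M] [Module (ZMod 2) M]
    (f : Ch E →ₗ[ZMod 2] M)
    (Q : Submodule (ZMod 2) M) (h : ∀ l, P l → f (s l) ∈ Q) {c : Ch E} (hc : c ∈ Sup P) :
    f c ∈ Q := by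
  have : Sup P ≤ Q.comap f := by
    apply Submodule.span_le.2
    rintro _ ⟨l, hl, rfl⟩
    exact h l hl
  exact this hc

lemma eq_on {P : List E → Prop} {M : Type*} [AddCommGroup M] [Module (ZMod 2) M]
    (f g : Ch E →ₗ[ZMod 2] M) (h : ∀ l, P l → f (s l) = g (s l)) {c : Ch E} (hc : c ∈ Sup P) :
    f c = g c := by
  have := map_mem (f - g) ⊥ (fun l hl => by simp [h l hl]) hc
  simpa [sub_eq_zero] using this

lemma sup_mono {P Q : List E → Prop} (h : ∀ l, P l → Q l) : Sup P ≤ Sup Q :=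
  Submodule.span_mono (Set.image_mono h)

lemma mem_sup_iff {P : List E → Prop} {c : Ch E} : c ∈ Sup P ↔ ∀ l ∈ c.support, P l := by
  have : Sup P = Finsupp.supported (ZMod 2) (ZMod 2) {l | P l} :=
    (Finsupp.supported_eq_span_single _ _).symm
  rw [this, Finsupp.mem_supported]
  rfl

lemma sup_and {P Q : List E → Prop} {c : Ch E} (h1 : c ∈ Sup P) (h2 : c ∈ Sup Q) :
    c ∈ Sup (fun l => P l ∧ Q l) := by
  rw [mem_sup_iff] at *
  exact fun l hl => ⟨h1 l hl, h2 l hl⟩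

lemma bdl_mem (l : List E) : bdl l ∈ Sup (fun f : List E => f.length + 1 = l.length ∧ f ⊆ l) := by
  induction l with
  | nil => simp [bdl]
  | cons v l ih =>
    refine Submodule.add_mem _ (s_mem (by simp)) ?_
    refine map_mem _ _ ?_ ih
    rintro f ⟨h1, h2⟩
    rw [cone_s]
    refine s_mem ⟨by simp [h1], ?_⟩
    exact List.cons_subset_cons _ h2

/-! ### the cocycles -/

/-- Cup product of the coboundaries of sign functions. -/
def W : List (E → ZMod 2) → List E → ZMod 2
  | [], [_] => 1
  | e :: es, u :: v :: l => (e u + e v) * W es (v :: l)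
  | _, _ => 0

/-- A primitive of the cocycle. -/
def P (e : E → ZMod 2) (es : List (E → ZMod 2)) : List E → ZMod 2
  | [] => 0
  | v :: l => e v * W es (v :: l)

lemma P_cone (e : E → ZMod 2) (es : List (E → ZMod 2)) (u : E) (c : Ch E) :
    lin (P e es) (cone u c) = e u * lin (W es) (cone u c) := by
  have : lin (P e es) ∘ₗ cone u = (e u) • (lin (W es) ∘ₗ cone u) := by
    apply ch_ext; intro l; simp [P]
  simpa using LinearMap.congr_fun this c

lemma W_nil (es : List (E → ZMod 2)) : W es ([] : List E) = 0 := by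
  cases es <;> simp [W]

lemma W_bdl (es : List (E → ZMod 2)) :
    (∀ l : List E, lin (W es) (bdl l) = 0) ∧
      ∀ e, ∀ l : List E, lin (P e es) (bdl l) = W (e :: es) l := by
  have key : (∀ l : List E, lin (W es) (bdl l) = 0) →
      ∀ e, ∀ l : List E, lin (P e es) (bdl l) = W (e :: es) l := by
    intro h e l
    match l with
    | [] => simp [bdl, W]
    | [u] => simp [bdl, W, P]
    | u :: v :: l =>
      have h1 := h (u :: v :: l)
      rw [bdl, map_add, lin_s] at h1
      rw [bdl, map_add, lin_s, P_cone]
      have h2 : lin (W es) (cone u (bdl (v :: l))) = W es (v :: l) := by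
        rw [← sub_eq_zero, CharTwo.sub_eq_add, add_comm]; exact h1
      rw [h2, P, W]; ring
  have h0 : ∀ l : List E, lin (W es) (bdl l) = 0 := by
    induction es with
    | nil =>
      have hc : ∀ (u v : E) (c : Ch E), lin (W []) (cone u (cone v c)) = 0 := by
        intro u v c
        have : lin (W []) ∘ₗ cone u ∘ₗ cone v = 0 := by
          apply ch_ext; intro l; simp [W]
        exact LinearMap.congr_fun this c
      intro l
      match l with
      | [] => simp [bdl]
      | [u] => simp [bdl, W]
      | [u, v] => simp [bdl, W]; decide
      | u :: v :: w :: l => simp [bdl, W, hc]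
    | cons e es ih =>
      intro l
      have hk : ∀ (h : ∀ l : List E, lin (W es) (bdl l) = 0),
        ∀ e, ∀ l : List E, lin (P e es) (bdl l) = W (e :: es) l := by
        intro h e l
        match l with
        | [] => simp [bdl, W]
        | [u] => simp [bdl, W, P]
        | u :: v :: l =>
          have h1 := h (u :: v :: l)
          rw [bdl, map_add, lin_s] at h1
          rw [bdl, map_add, lin_s, P_cone]
          have h2 : lin (W es) (cone u (bdl (v :: l))) = W es (v :: l) := by
            rw [← sub_eq_zero, CharTwo.sub_eq_add, add_comm]; exact h1
          rw [h2, P, W]; ring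
      have hl : lin (W (e :: es)) = lin (P e es) ∘ₗ bd := by
        apply ch_ext; intro l
        simp [hk (ih (fun h e l => hk h e l)) e l]
      rw [hl]; simp [bd_bdl]
  exact ⟨h0, key h0⟩

lemma W_bd (e : E → ZMod 2) (es : List (E → ZMod 2)) (c : Ch E) :
    lin (W (e :: es)) c = lin (P e es) (bd c) := by
  have hl : lin (W (e :: es)) = lin (P e es) ∘ₗ bd := by
    apply ch_ext; intro l
    simp [(W_bdl es).2 e l]
  rw [hl]; rfl

/-- If some sign function is constant along the list, the cocycle vanishes. -/
lemma W_zero (es : List (E → ZMod 2)) (l : List E) (e : E → ZMod 2) (he : e ∈ es)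
    (h : ∀ u ∈ l, ∀ v ∈ l, e u = e v) : W es l = 0 := by
  induction es generalizing l with
  | nil => simp at he
  | cons a es ih =>
    match l with
    | [] => simp [W]
    | [u] => simp [W]
    | u :: v :: l =>
      rw [W]
      rcases List.mem_cons.1 he with rfl | he
      · rw [h u (by simp) v (by simp), CharTwo.add_self_eq_zero, zero_mul]
      · rw [ih (v :: l) he, mul_zero]
        intro x hx y hy
        exact h x (List.mem_cons_of_mem _ hx) y (List.mem_cons_of_mem _ hy)

/-! ### antipode -/

variable [AddCommGroup E]

/-- Antipode on chains. -/
def nu : Ch E →ₗ[ZMod 2] Ch E := lin fun l => s (l.map Neg.neg)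

@[simp] lemma nu_s (l : List E) : nu (s l) = s (l.map Neg.neg) := by simp [nu]

lemma nu_cone (v : E) (c : Ch E) : nu (cone v c) = cone (-v) (nu c) := by
  have : nu ∘ₗ cone v = cone (-v) ∘ₗ nu := by
    apply ch_ext; intro l; simp
  exact LinearMap.congr_fun this c

lemma nu_bdl (l : List E) : nu (bdl l) = bdl (l.map Neg.neg) := by
  induction l with
  | nil => simp [bdl]
  | cons v l ih => simp [bdl, nu_cone, ih]

lemma nu_bd (c : Ch E) : nu (bd c) = bd (nu c) := by
  have : nu ∘ₗ bd = bd ∘ₗ (nu (E := E)) := by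
    apply ch_ext; intro l; simp [nu_bdl]
  exact LinearMap.congr_fun this c

lemma nu_nu (c : Ch E) : nu (nu c) = c := by
  have : nu ∘ₗ nu = LinearMap.id (R := ZMod 2) (M := Ch E) := by
    apply ch_ext; intro l; simp
  exact LinearMap.congr_fun this c

lemma W_neg (X : Set E) (es : List (E → ZMod 2)) (hes : ∀ e ∈ es, ∀ x ∈ X, e (-x) = e x + 1)
    (l : List E) (hl : ∀ v ∈ l, v ∈ X) : W es (l.map Neg.neg) = W es l := by
  induction es generalizing l with
  | nil =>
    match l with
    | [] => simp [W]
    | [u] => simp [W]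
    | u :: v :: l => simp [W]
  | cons a es ih =>
    match l with
    | [] => simp [W]
    | [u] => simp [W]
    | u :: v :: l =>
      have := ih (fun e he => hes e (List.mem_cons_of_mem _ he)) (v :: l)
        (fun x hx => hl x (List.mem_cons_of_mem _ hx))
      simp only [List.map_cons] at this
      simp only [List.map_cons, W, this]
      rw [hes a (by simp) u (hl u (by simp)), hes a (by simp) v (hl v (by simp))]
      have : a u + 1 + (a v + 1) = a u + a v := by
        have h : (1 : ZMod 2) + 1 = 0 := by decide
        linear_combination h
      rw [this]

lemma P_neg (X : Set E) (e : E → ZMod 2) (es : List (E → ZMod 2))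
    (he : ∀ x ∈ X, e (-x) = e x + 1)
    (hes : ∀ e ∈ es, ∀ x ∈ X, e (-x) = e x + 1)
    (l : List E) (hl : ∀ v ∈ l, v ∈ X) : P e es l + P e es (l.map Neg.neg) = W es l := by
  cases l with
  | nil => simp [P, W_nil]
  | cons v l =>
    have := W_neg X es hes (v :: l) hl
    simp only [List.map_cons] at this
    simp only [List.map_cons, P, this]
    rw [he v (hl v (by simp))]
    have h : (1 : ZMod 2) + 1 = 0 := by decide
    linear_combination (e v * W es (v :: l)) * h

/-- The Smith-type argument. -/
lemma smith (X : Set E) (h : ℕ → Ch E) (n : ℕ) (hX : ∀ i ≤ n, h i ∈ Sup (fun l => ∀ v ∈ l, v ∈ X))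
    (h0 : ∃ v, h 0 = s [v]) (hb : ∀ i < n, bd (h (i+1)) = h i + nu (h i))
    (es : List (E → ZMod 2)) (hlen : es.length ≤ n)
    (hes : ∀ e ∈ es, ∀ x ∈ X, e (-x) = e x + 1) :
    lin (W es) (h es.length) = 1 := by
  induction es with
  | nil =>
    obtain ⟨v, hv⟩ := h0
    simp [hv, W]
  | cons e es ih =>
    simp only [List.length_cons] at hlen ⊢
    rw [W_bd, hb _ (by omega), ← ih (by omega) fun e he => hes e (List.mem_cons_of_mem _ he)]
    rw [map_add]
    refine eq_on (lin (P e es) + lin (P e es) ∘ₗ nu) (lin (W es)) ?_ (hX _ (by omega))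
    intro l hl
    simp only [LinearMap.add_apply, LinearMap.comp_apply, nu_s, lin_s]
    exact P_neg X e es (hes e (by simp)) (fun e he => hes e (List.mem_cons_of_mem _ he)) l hl

/-! ### octahedral chains -/

/-- The hemispheres of the octahedral sphere. -/
def oct (b : ℕ → E) : ℕ → Ch E
  | 0 => s [b 0]
  | i + 1 => cone (b (i+1)) (oct b i + nu (oct b i))

lemma bd_oct (b : ℕ → E) (i : ℕ) : bd (oct b (i+1)) = oct b i + nu (oct b i) := by
  have key : bd (oct b i + nu (oct b i)) = 0 := by
    induction i with
    | zero => simp [oct, bdl]; exact two_ch _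
    | succ i ih =>
      have h1 : bd (oct b (i+1)) = oct b i + nu (oct b i) := by
        rw [oct, bd_cone, ih]; simp
      rw [map_add, ← nu_bd, h1, map_add, nu_nu, add_comm (nu _)]
      exact two_ch _
  rw [oct, bd_cone, key]; simp

/-! ### subdivision -/

variable [Module ℝ E]

/-- Barycenter. -/
def bary (l : List E) : E := (l.length : ℝ)⁻¹ • l.sum

lemma bary_neg (l : List E) : bary (l.map Neg.neg) = - bary l := by
  have : (l.map Neg.neg).sum = - l.sum := by
    induction l with
    | nil => simp
    | cons a l ih => simp [ih]; abel
  simp [bary, this]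

/-- Barycentric subdivision, on lists of length n. -/
def sd : ℕ → Ch E →ₗ[ZMod 2] Ch E
  | 0 => LinearMap.id
  | n + 1 => lin fun l => cone (bary l) (sd n (bdl l))

lemma bd_sd (n : ℕ) (c : Ch E) : bd (sd (n+1) c) = sd n (bd c) := by
  induction n generalizing c with
  | zero =>
    have : bd ∘ₗ sd 1 = sd 0 ∘ₗ (bd (E := E)) := by
      apply ch_ext; intro l; simp [sd, bd_cone, bd_bdl]
    exact LinearMap.congr_fun this c
  | succ n ih =>
    have : bd ∘ₗ sd (n+1+1) = sd (n+1) ∘ₗ (bd (E := E)) := by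
      apply ch_ext; intro l
      rw [LinearMap.comp_apply, sd, lin_s, bd_cone, ih, bd_bdl]; simp
    exact LinearMap.congr_fun this c

lemma nu_sd (n : ℕ) (c : Ch E) : nu (sd n c) = sd n (nu c) := by
  induction n generalizing c with
  | zero => simp [sd]
  | succ n ih =>
    have : nu ∘ₗ sd (n+1) = sd (n+1) ∘ₗ (nu (E := E)) := by
      apply ch_ext; intro l
      simp [sd, nu_cone, ih, nu_bdl, bary_neg]
    exact LinearMap.congr_fun this c

/-- Iterated subdivision. -/
def sdn (k n : ℕ) : Ch E →ₗ[ZMod 2] Ch E := (sd n) ^ k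

lemma sdn_succ (k n : ℕ) (c : Ch E) : sdn (k+1) n c = sd n (sdn k n c) := by
  simp [sdn, pow_succ']

lemma bd_sdn (k n : ℕ) (c : Ch E) : bd (sdn k (n+1) c) = sdn k n (bd c) := by
  induction k with
  | zero => simp [sdn]
  | succ k ih => rw [sdn_succ, bd_sd, ih, sdn_succ]

lemma nu_sdn (k n : ℕ) (c : Ch E) : nu (sdn k n c) = sdn k n (nu c) := by
  induction k with
  | zero => simp [sdn]
  | succ k ih => rw [sdn_succ, nu_sd, ih, sdn_succ]

lemma sdn_pt (k : ℕ) (v : E) : sdn k 1 (s [v]) = s [v] := by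
  induction k with
  | zero => simp [sdn]
  | succ k ih => rw [sdn_succ, ih]; simp [sd, bdl, bary]

lemma bary_mem {C : Set E} (hC : Convex ℝ C) {l : List E} (hl : ∀ v ∈ l, v ∈ C) (h0 : l ≠ []) :
    bary l ∈ C := by
  have hpos : (l.length : ℝ) ≠ 0 := by simpa using h0
  have : bary l = ∑ i : Fin l.length, (l.length : ℝ)⁻¹ • l[i] := by
    rw [← Finset.smul_sum]; simp [bary, Fin.sum_univ_getElem]
  rw [this]
  refine hC.sum_mem (fun _ _ => by positivity) ?_ (fun i _ => hl _ (by simp))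
  simp [hpos]

lemma sd_conv {C : Set E} (hC : Convex ℝ C) (n : ℕ) (l : List E) (hn : l.length = n)
    (hl : ∀ v ∈ l, v ∈ C) :
    sd n (s l) ∈ Sup (fun l' : List E => l'.length = n ∧ ∀ v ∈ l', v ∈ C) := by
  induction n generalizing l with
  | zero => exact s_mem ⟨hn, hl⟩
  | succ n ih =>
    rw [sd, lin_s]
    have h1 : sd n (bdl l) ∈ Sup (fun l' : List E => l'.length = n ∧ ∀ v ∈ l', v ∈ C) := by
      refine map_mem _ _ ?_ (bdl_mem l)
      rintro f ⟨h1, h2⟩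
      exact ih f (by omega) (fun v hv => hl v (h2 hv))
    refine map_mem _ _ ?_ h1
    rintro f ⟨h1, h2⟩
    rw [cone_s]
    refine s_mem ⟨by simp [h1], ?_⟩
    intro v hv
    rcases List.mem_cons.1 hv with rfl | hv
    · exact bary_mem hC hl (by rintro rfl; simp at hn)
    · exact h2 v hv

end

noncomputable section

variable {E : Type*} [NormedAddCommGroup E] [NormedSpace ℝ E]

lemma bary_dist {r : ℝ} {l : List E} (hl : ∀ u ∈ l, ∀ v ∈ l, ‖u - v‖ ≤ r) {v : E}
    (hv : v ∈ l) : ‖bary l - v‖ ≤ (1 - (l.length : ℝ)⁻¹) * r := by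
  have h0 : l ≠ [] := by rintro rfl; simp at hv
  have hpos : (0 : ℝ) < l.length := by
    have := List.length_pos_of_ne_nil h0
    exact_mod_cast this
  have hr : 0 ≤ r := le_trans (norm_nonneg _) (hl v hv v hv)
  obtain ⟨j, hj, rfl⟩ := List.getElem_of_mem hv
  have : bary l - l[j] = (l.length : ℝ)⁻¹ • ∑ i : Fin l.length, (l[i] - l[j]) := by
    rw [Finset.sum_sub_distrib, smul_sub]
    simp [bary, Fin.sum_univ_getElem, ← Nat.cast_smul_eq_nsmul ℝ, smul_smul, hpos.ne']
  rw [this, norm_smul, norm_inv, Real.norm_of_nonneg hpos.le]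
  have hs : ‖∑ i : Fin l.length, (l[i] - l[j])‖ ≤ (l.length - 1) * r := by
    rw [← Finset.add_sum_erase _ _ (Finset.mem_univ (⟨j, hj⟩ : Fin l.length))]
    simp only [Fin.getElem_fin, sub_self, zero_add]
    refine (norm_sum_le_of_le _ (f := fun i : Fin l.length => l[i] - l[j]) (n := fun _ => r)
      (fun i _ => hl _ (by simp) _ (by simp))).trans ?_
    rw [Finset.sum_const, Finset.card_erase_of_mem (Finset.mem_univ _)]
    simp only [Finset.card_univ, Fintype.card_fin, nsmul_eq_mul]
    rw [Nat.cast_sub (by omega)]; simp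
  calc _ ≤ (l.length : ℝ)⁻¹ * ((l.length - 1) * r) := by gcongr
    _ = _ := by field_simp

lemma sd_mesh {r : ℝ} (N n : ℕ) (hnN : n ≤ N) (l : List E) (hn : l.length = n)
    (hr : 0 ≤ r) (hl : ∀ u ∈ l, ∀ v ∈ l, ‖u - v‖ ≤ r) :
    sd n (s l) ∈ Sup (fun l' : List E => l'.length = n ∧ (∀ v ∈ l', v ∈ convexHull ℝ {x | x ∈ l}) ∧
      ∀ u ∈ l', ∀ v ∈ l', ‖u - v‖ ≤ (1 - (N : ℝ)⁻¹) * r) := by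
  induction n generalizing l with
  | zero =>
    have : l = [] := by simpa using hn
    subst this
    exact s_mem (by simp)
  | succ n ih =>
    rw [sd, lin_s]
    have h1 : sd n (bdl l) ∈ Sup (fun l' : List E => l'.length = n ∧
        (∀ v ∈ l', v ∈ convexHull ℝ {x | x ∈ l}) ∧
        ∀ u ∈ l', ∀ v ∈ l', ‖u - v‖ ≤ (1 - (N : ℝ)⁻¹) * r) := by
      refine map_mem _ _ ?_ (bdl_mem l)
      rintro f ⟨h1, h2⟩
      refine sup_mono ?_ (ih (by omega) f (by omega) (fun u hu v hv => hl u (h2 hu) v (h2 hv)))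
      rintro l' ⟨a, b, c⟩
      exact ⟨a, fun v hv => convexHull_mono (fun x hx => h2 hx) (b v hv), c⟩
    refine map_mem _ _ ?_ h1
    rintro f ⟨h1, h2, h3⟩
    rw [cone_s]
    have hq : (1 - (l.length : ℝ)⁻¹) * r ≤ (1 - (N : ℝ)⁻¹) * r := by
      rw [hn]
      have : (0 : ℝ) < ((n + 1 : ℕ) : ℝ) := by positivity
      gcongr
    have hb : ∀ x ∈ convexHull ℝ {x | x ∈ l}, ‖x - bary l‖ ≤ (1 - (N : ℝ)⁻¹) * r := by
      intro x hx
      have : convexHull ℝ {x | x ∈ l} ⊆ Metric.closedBall (bary l) ((1 - (N : ℝ)⁻¹) * r) := by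
        refine convexHull_min ?_ (convex_closedBall _ _)
        intro v hv
        rw [mem_closedBall_iff_norm, norm_sub_rev]
        exact (bary_dist hl hv).trans hq
      exact mem_closedBall_iff_norm.1 (this hx)
    have hbm : bary l ∈ convexHull ℝ {x | x ∈ l} :=
      bary_mem (convex_convexHull _ _) (fun v hv => subset_convexHull _ _ hv)
        (by rintro rfl; simp at hn)
    refine s_mem ⟨by simp [h1], ?_, ?_⟩
    · intro v hv
      rcases List.mem_cons.1 hv with rfl | hv
      · exact hbm
      · exact h2 v hv
    · intro u hu v hv
      rcases List.mem_cons.1 hu with rfl | hu <;> rcases List.mem_cons.1 hv with rfl | hv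
      · exact hb _ hbm
      · rw [norm_sub_rev]; exact hb _ (h2 v hv)
      · exact hb _ (h2 u hu)
      · exact h3 u hu v hv

lemma sdn_mesh {r : ℝ} (N k : ℕ) (hN : 1 ≤ N) (hr : 0 ≤ r) {c : Ch E}
    (hc : c ∈ Sup (fun l : List E => l.length = N ∧ ∀ u ∈ l, ∀ v ∈ l, ‖u - v‖ ≤ r)) :
    sdn k N c ∈ Sup (fun l : List E => l.length = N ∧
      ∀ u ∈ l, ∀ v ∈ l, ‖u - v‖ ≤ (1 - (N : ℝ)⁻¹) ^ k * r) := by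
  have hq : 0 ≤ 1 - (N : ℝ)⁻¹ := by
    have : (1 : ℝ) ≤ N := by exact_mod_cast hN
    have := inv_le_one_of_one_le₀ this
    linarith
  induction k with
  | zero => simpa [sdn] using hc
  | succ k ih =>
    rw [sdn_succ]
    refine map_mem _ _ ?_ ih
    rintro l ⟨h1, h2⟩
    refine sup_mono ?_ (sd_mesh N N le_rfl l h1 (by positivity) h2)
    rintro l' ⟨a, _, b⟩
    refine ⟨a, fun u hu v hv => (b u hu v hv).trans (le_of_eq (by ring))⟩

lemma sdn_conv {ι : Type*} {C : ι → Set E} (hC : ∀ i, Convex ℝ (C i)) (n k : ℕ) {c : Ch E}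
    (hc : c ∈ Sup (fun l : List E => l.length = n ∧ ∃ i, ∀ v ∈ l, v ∈ C i)) :
    sdn k n c ∈ Sup (fun l : List E => l.length = n ∧ ∃ i, ∀ v ∈ l, v ∈ C i) := by
  induction k with
  | zero => simpa [sdn] using hc
  | succ k ih =>
    rw [sdn_succ]
    refine map_mem _ _ ?_ ih
    rintro l ⟨h1, i, h2⟩
    refine sup_mono ?_ (sd_conv (hC i) n l h1 h2)
    rintro l' ⟨a, b⟩
    exact ⟨a, i, b⟩

end


/-! ### Borsuk-Ulam -/

lemma eq_zero_of_self_neg {E : Type*} [AddCommGroup E] [Module ℝ E] {v : E} (h : v = -v) :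
    v = 0 := by
  have h1 : (2 : ℝ) • v = 0 := by rw [two_smul]; nth_rewrite 2 [h]; exact add_neg_cancel v
  exact (smul_eq_zero.1 h1).resolve_left two_ne_zero

lemma exists_odd_sign (E : Type*) [AddCommGroup E] [Module ℝ E] :
    ∃ η : E → ZMod 2, ∀ v ≠ 0, η (-v) = η v + 1 := by
  classical
  refine ⟨fun v => if WellOrderingRel v (-v) then 1 else 0, fun v hv => ?_⟩
  have hne : v ≠ -v := fun h => hv (eq_zero_of_self_neg h)
  beta_reduce
  rw [neg_neg]
  by_cases h1 : WellOrderingRel v (-v)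
  · have h2 : ¬ WellOrderingRel (-v) v := asymm h1
    simp only [h1, h2, if_true, if_false]
    decide
  · have h2 : WellOrderingRel (-v) v := by
      rcases trichotomous_of WellOrderingRel v (-v) with h | h | h
      · exact absurd h h1
      · exact absurd h hne
      · exact h
    simp [h1, h2]

/-- Closed faces of the cross polytope. -/
def face {n : ℕ} (t : {t : Fin n → ℝ // ∀ j, t j = 1 ∨ t j = -1}) : Set (Fin n → ℝ) :=
  {v | (∀ j, 0 ≤ t.1 j * v j) ∧ ∑ j, t.1 j * v j = 1}

lemma face_convex {n : ℕ} (t : {t : Fin n → ℝ // ∀ j, t j = 1 ∨ t j = -1}) :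
    Convex ℝ (face t) := by
  rintro x ⟨hx1, hx2⟩ y ⟨hy1, hy2⟩ a b ha hb hab
  constructor
  · intro j
    have := mul_nonneg ha (hx1 j)
    have := mul_nonneg hb (hy1 j)
    simp only [Pi.add_apply, Pi.smul_apply, smul_eq_mul]
    nlinarith
  · have : ∑ j, t.1 j * (a • x + b • y) j = a * ∑ j, t.1 j * x j + b * ∑ j, t.1 j * y j := by
      rw [Finset.mul_sum, Finset.mul_sum, ← Finset.sum_add_distrib]
      refine Finset.sum_congr rfl fun j _ => ?_
      simp only [Pi.add_apply, Pi.smul_apply, smul_eq_mul]; ring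
    rw [this, hx2, hy2]; linarith

lemma face_abs {n : ℕ} (t : {t : Fin n → ℝ // ∀ j, t j = 1 ∨ t j = -1}) {v : Fin n → ℝ}
    (hv : v ∈ face t) : ∑ j, |v j| = 1 := by
  rw [← hv.2]
  refine Finset.sum_congr rfl fun j _ => ?_
  have h := hv.1 j
  rcases t.2 j with h1 | h1 <;> rw [h1] at h ⊢
  · rw [abs_of_nonneg (by linarith)]; ring
  · rw [abs_of_nonpos (by linarith)]; ring

lemma face_neg {n : ℕ} (t : {t : Fin n → ℝ // ∀ j, t j = 1 ∨ t j = -1}) :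
    ∃ t' : {t : Fin n → ℝ // ∀ j, t j = 1 ∨ t j = -1}, ∀ v ∈ face t, -v ∈ face t' := by
  refine ⟨⟨fun j => - t.1 j, fun j => ?_⟩, ?_⟩
  · rcases t.2 j with h | h <;> simp [h]
  · rintro v ⟨h1, h2⟩
    exact ⟨fun j => by simpa using h1 j, by simpa using h2⟩

/-- Standard basis indexed by naturals. -/
def bas (n : ℕ) (i : ℕ) : Fin n → ℝ := fun j => if (j : ℕ) = i then 1 else 0

lemma oct_mem (d i : ℕ) (hi : i ≤ d) : oct (bas (d+1)) i ∈ Sup (fun l : List (Fin (d+1) → ℝ) =>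
    l.length = i + 1 ∧ ∃ t, ∀ v ∈ l, v ∈ face t ∧ ∀ j : Fin (d+1), i < j → v j = 0) := by
  induction i with
  | zero =>
    refine s_mem ⟨rfl, ⟨fun _ => 1, fun _ => Or.inl rfl⟩, ?_⟩
    intro v hv
    obtain rfl : v = bas (d+1) 0 := by simpa using hv
    refine ⟨⟨?_, ?_⟩, ?_⟩
    · intro j; simp only [bas, one_mul]; split_ifs <;> norm_num
    · simp only [bas, one_mul]
      rw [Finset.sum_eq_single (⟨0, by omega⟩ : Fin (d+1))]
      · simp
      · intro b _ hb; rw [if_neg]; intro h; exact hb (Fin.ext h)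
      · simp
    · intro j hj; simp only [bas]; rw [if_neg (by omega)]
  | succ i ih =>
    have ih := ih (by omega)
    have h1 : oct (bas (d+1)) i + nu (oct (bas (d+1)) i) ∈ Sup (fun l : List (Fin (d+1) → ℝ) =>
        l.length = i + 1 ∧ ∃ t, ∀ v ∈ l, v ∈ face t ∧ ∀ j : Fin (d+1), i < j → v j = 0) := by
      refine Submodule.add_mem _ ih (map_mem _ _ ?_ ih)
      rintro l ⟨h1, t, h2⟩
      rw [nu_s]
      obtain ⟨t', ht'⟩ := face_neg t
      refine s_mem ⟨by simp [h1], t', ?_⟩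
      intro v hv
      obtain ⟨w, hw, rfl⟩ := List.mem_map.1 hv
      exact ⟨ht' w (h2 w hw).1, fun j hj => by simp [(h2 w hw).2 j hj]⟩
    rw [oct]
    refine map_mem _ _ ?_ h1
    rintro l ⟨h1, t, h2⟩
    rw [cone_s]
    have hi' : i + 1 < d + 1 := by omega
    refine s_mem ⟨by simp [h1], ⟨fun j => if (j : ℕ) = i + 1 then 1 else t.1 j, fun j => ?_⟩, ?_⟩
    · by_cases h : (j : ℕ) = i + 1
      · simp [h]
      · simpa [h] using t.2 j
    · intro v hv
      rcases List.mem_cons.1 hv with rfl | hv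
      · refine ⟨⟨?_, ?_⟩, ?_⟩
        · intro j; simp only [bas]; split_ifs <;> norm_num
        · simp only [bas]
          rw [Finset.sum_eq_single (⟨i + 1, hi'⟩ : Fin (d+1))]
          · simp
          · intro b _ hb; rw [if_neg (c := (b : ℕ) = i + 1), if_neg]
            · simp
            · intro h; exact hb (Fin.ext h)
            · intro h; exact hb (Fin.ext h)
          · simp
        · intro j hj; simp only [bas]; rw [if_neg (by omega)]
      · obtain ⟨⟨a, b⟩, c⟩ := h2 v hv
        have he : ∀ j : Fin (d+1), (if (j : ℕ) = i + 1 then 1 else t.1 j) * v j = t.1 j * v j := by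
          intro j
          by_cases h : (j : ℕ) = i + 1
          · rw [c j (by omega)]; simp
          · simp [h]
        refine ⟨⟨fun j => ?_, ?_⟩, fun j hj => c j (by omega)⟩
        · simp only [he]; exact a j
        · simp only [he]; exact b

/-- Coordinate embedding. -/
def emb (d m : ℕ) : (Fin (d+1) → ℝ) →ₗ[ℝ] EuclideanSpace ℝ (Fin (m+1)) where
  toFun x := WithLp.toLp 2 fun j => if h : (j : ℕ) < d + 1 then x ⟨j, h⟩ else 0
  map_add' x y := by
    ext j
    by_cases h : (j : ℕ) < d + 1 <;> simp [h, -Order.lt_add_one_iff]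
  map_smul' a x := by
    ext j
    by_cases h : (j : ℕ) < d + 1 <;> simp [h, -Order.lt_add_one_iff]

lemma emb_inj (d m : ℕ) (hd : d ≤ m) (x : Fin (d+1) → ℝ) (h : emb d m x = 0) : x = 0 := by
  ext j
  have := congrArg (fun v : EuclideanSpace ℝ (Fin (m+1)) => v ⟨j, by omega⟩) h
  simpa [emb, -Order.lt_add_one_iff] using this

lemma exists_J (m : ℕ) (hm : Odd m) :
    ∃ J : EuclideanSpace ℝ (Fin (m+1)) →ₗ[ℝ] EuclideanSpace ℝ (Fin (m+1)),
      (∀ x, ‖J x‖ = ‖x‖) ∧ ∀ x, J (J x) = -x := by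
  obtain ⟨k, rfl⟩ := hm
  have hf : Module.finrank ℝ (EuclideanSpace ℂ (Fin (k+1))) = 2 * k + 1 + 1 := by
    rw [← Module.finrank_mul_finrank ℝ ℂ]
    simp; ring
  let _ : InnerProductSpace ℝ (EuclideanSpace ℂ (Fin (k+1))) := InnerProductSpace.rclikeToReal ℂ _
  have hf' : Module.finrank ℝ (EuclideanSpace ℂ (Fin (k+1))) = 2 * k + 1 + 1 := hf
  let φ : EuclideanSpace ℂ (Fin (k+1)) ≃ₗᵢ[ℝ] EuclideanSpace ℝ (Fin (2 * k + 1 + 1)) :=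
    ((stdOrthonormalBasis ℝ (EuclideanSpace ℂ (Fin (k+1)))).reindex (finCongr hf')).repr
  refine ⟨⟨⟨fun x => φ (Complex.I • φ.symm x), ?_⟩, ?_⟩, ?_, ?_⟩
  · intro x y; simp
  · intro a x
    simp only [map_smul, RingHom.id_apply]
    rw [smul_comm, map_smul]
  · intro x; simp [norm_smul]
  · intro x; simp [smul_smul]

theorem borsuk_ulam (d : ℕ) (g : (Fin (d+1) → ℝ) → (Fin d → ℝ))
    (hg : ContinuousOn g {x | x ≠ 0}) (hodd : ∀ x ≠ 0, g (-x) = - g x)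
    (hne : ∀ x ≠ 0, g x ≠ 0) : False := by
  classical
  set K : Set (Fin (d+1) → ℝ) := {v | ∑ j, |v j| = 1} with hK
  have hK0 : ∀ v ∈ K, v ≠ 0 := by
    rintro v hv rfl
    simp [hK] at hv
  have hK1 : ∀ v ∈ K, ‖v‖ ≤ 1 := by
    intro v hv
    rw [pi_norm_le_iff_of_nonneg zero_le_one]
    intro j
    rw [Real.norm_eq_abs, ← (show ∑ j, |v j| = 1 from hv)]
    exact Finset.single_le_sum (f := fun j => |v j|) (fun _ _ => abs_nonneg _) (Finset.mem_univ j)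
  have hKc : IsCompact K := by
    refine (isCompact_closedBall (0 : Fin (d+1) → ℝ) 1).of_isClosed_subset ?_ ?_
    · exact isClosed_eq (by fun_prop) continuous_const
    · intro v hv; simpa using hK1 v hv
  have hgK : ContinuousOn g K := hg.mono hK0
  obtain ⟨c, hc, hcg⟩ : ∃ c > 0, ∀ x ∈ K, c ≤ ‖g x‖ := by
    rcases K.eq_empty_or_nonempty with h | h
    · exact ⟨1, one_pos, by simp [h]⟩
    · obtain ⟨x, hx, hm⟩ := hKc.exists_isMinOn h hgK.norm
      exact ⟨‖g x‖, norm_pos_iff.2 (hne x (hK0 x hx)), fun y hy => hm hy⟩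
  have huc := hKc.uniformContinuousOn_of_continuous hgK
  obtain ⟨δ, hδ, hδg⟩ := Metric.uniformContinuousOn_iff.1 huc c hc
  obtain ⟨k, hk⟩ : ∃ k : ℕ, (1 - ((d + 1 : ℕ) : ℝ)⁻¹) ^ k < δ / 2 := by
    apply exists_pow_lt_of_lt_one (by positivity)
    have : (0 : ℝ) < ((d + 1 : ℕ) : ℝ)⁻¹ := by positivity
    linarith
  obtain ⟨η, hη⟩ := exists_odd_sign (Fin (d+1) → ℝ)
  -- the sign functions
  let e : Fin d → (Fin (d+1) → ℝ) → ZMod 2 := fun j v =>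
    if 0 < g v j then 1 else if g v j < 0 then 0 else η v
  have he : ∀ j, ∀ x ∈ K, e j (-x) = e j x + 1 := by
    intro j x hx
    have hx0 := hK0 x hx
    simp only [e, hodd x hx0, Pi.neg_apply, hη x hx0]
    rcases lt_trichotomy (g x j) 0 with h | h | h
    · simp [h, h.le]
    · simp [h]
    · simp only [Left.neg_pos_iff, not_lt.2 h.le, if_false, Left.neg_neg_iff, h, if_true]; decide
  let h : ℕ → Ch (Fin (d+1) → ℝ) := fun i => sdn k (i+1) (oct (bas (d+1)) i)
  have hface : ∀ i ≤ d, h i ∈ Sup (fun l : List (Fin (d+1) → ℝ) =>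
      l.length = i + 1 ∧ ∃ t, ∀ v ∈ l, v ∈ face t) := by
    intro i hi
    refine sdn_conv face_convex _ _ (sup_mono ?_ (oct_mem d i hi))
    rintro l ⟨a, t, b⟩
    exact ⟨a, t, fun v hv => (b v hv).1⟩
  have hone := smith K h d
    (fun i hi => sup_mono (fun l hl v hv => by
      obtain ⟨_, t, ht⟩ := hl
      exact face_abs t (ht v hv)) (hface i hi))
    ⟨_, sdn_pt k _⟩
    (fun i _ => by
      simp only [h]
      rw [bd_sdn, bd_oct, map_add, nu_sdn])
    (List.ofFn e) (by simp) (by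
      intro f hf x hx
      obtain ⟨j, rfl⟩ := (List.mem_ofFn' _ _).1 hf
      exact he j x hx)
  rw [List.length_ofFn] at hone
  have hmesh : h d ∈ Sup (fun l : List (Fin (d+1) → ℝ) => l.length = d + 1 ∧
      ∀ u ∈ l, ∀ v ∈ l, ‖u - v‖ ≤ (1 - ((d + 1 : ℕ) : ℝ)⁻¹) ^ k * 2) := by
    refine sdn_mesh (d+1) k (by omega) (by norm_num) (sup_mono ?_ (oct_mem d d le_rfl))
    rintro l ⟨a, t, b⟩
    refine ⟨a, fun u hu v hv => (norm_sub_le _ _).trans ?_⟩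
    have := hK1 u (face_abs t (b u hu).1)
    have := hK1 v (face_abs t (b v hv).1)
    linarith
  have hboth : h d ∈ Sup (fun l : List (Fin (d+1) → ℝ) => (l.length = d + 1 ∧
      ∃ t, ∀ v ∈ l, v ∈ face t) ∧
      (l.length = d + 1 ∧ ∀ u ∈ l, ∀ v ∈ l, ‖u - v‖ ≤ (1 - ((d + 1 : ℕ) : ℝ)⁻¹) ^ k * 2)) :=
    sup_and (hface d le_rfl) hmesh
  have hzero : lin (W (List.ofFn e)) (h d) = (0 : Ch (Fin (d+1) → ℝ) →ₗ[ZMod 2] ZMod 2) (h d) := by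
    refine eq_on _ _ ?_ hboth
    rintro l ⟨⟨hlen, t, ht⟩, -, hl⟩
    rw [lin_s, LinearMap.zero_apply]
    obtain ⟨v, hv⟩ : ∃ v, v ∈ l := List.exists_mem_of_length_pos (by omega)
    have hlK : ∀ v ∈ l, v ∈ K := fun v hv => face_abs t (ht v hv)
    obtain ⟨j, hj⟩ : ∃ j, c ≤ |g v j| := by
      by_contra! hcon
      have := hcg v (hlK v hv)
      have h2 : ‖g v‖ < c := (pi_norm_lt_iff hc).2 hcon
      linarith
    have hcl : ∀ u ∈ l, |g u j - g v j| < c := by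
      intro u hu
      have h1 := hδg u (hlK u hu) v (hlK v hv) (by
        rw [dist_eq_norm]; exact (hl u hu v hv).trans_lt (by linarith))
      have h2 := dist_le_pi_dist (g u) (g v) j
      rw [Real.dist_eq] at h2
      linarith
    have hs : ∀ u ∈ l, e j u = e j v := by
      intro u hu
      have h1 := abs_lt.1 (hcl u hu)
      rcases le_abs'.1 hj with h2 | h2
      · have a : g u j < 0 := by linarith
        have b : g v j < 0 := by linarith
        simp [e, a, b, not_lt.2 a.le, not_lt.2 b.le]
      · have a : 0 < g u j := by linarith
        have b : 0 < g v j := by linarith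
        simp [e, a, b]
    refine W_zero _ _ (e j) ((List.mem_ofFn' _ _).2 ⟨j, rfl⟩) ?_
    intro u hu w hw
    rw [hs u hu, hs w hw]
  rw [hone] at hzero
  simp at hzero

end BU

theorem stmt_11 (m d : ℕ) (hm : Odd m) (h2 : 2 ≤ m) (hd : d ≤ m)
    (W : Set (EuclideanSpace ℝ (Fin (m+1)) × EuclideanSpace ℝ (Fin (m+1))))
    (hW : W = {p | ‖p.1‖ = 1 ∧ ‖p.2‖ = 1 ∧ p.1 ≠ p.2 ∧ p.1 ≠ -p.2}) :
    ¬ ∃ g : W → Metric.sphere (0 : EuclideanSpace ℝ (Fin d)) 1,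
        Continuous g ∧
        ∀ p q : W, (q : EuclideanSpace ℝ (Fin (m+1)) × EuclideanSpace ℝ (Fin (m+1)))
            = -(p : EuclideanSpace ℝ (Fin (m+1)) × EuclideanSpace ℝ (Fin (m+1))) →
          g q = -g p := by
  classical
  rintro ⟨g, hgc, hgo⟩
  obtain ⟨J, hJn, hJ2⟩ := BU.exists_J m hm
  let ι : (Fin (d+1) → ℝ) →ₗ[ℝ] EuclideanSpace ℝ (Fin (m+1)) := BU.emb d m
  have hι : ∀ x, x ≠ 0 → ι x ≠ 0 := fun x hx h => hx (BU.emb_inj d m hd x h)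
  have hιc : Continuous ι := ι.continuous_of_finiteDimensional
  let u : (Fin (d+1) → ℝ) → EuclideanSpace ℝ (Fin (m+1)) := fun x => ‖ι x‖⁻¹ • ι x
  have hu1 : ∀ x ≠ 0, ‖u x‖ = 1 := fun x hx => norm_smul_inv_norm (𝕜 := ℝ) (hι x hx)
  have hun : ∀ x, u (-x) = - u x := fun x => by simp [u]
  have huW : ∀ x ≠ 0, (u x, J (u x)) ∈ W := by
    intro x hx
    have h1 := hu1 x hx
    have h0 : u x ≠ 0 := by rw [← norm_ne_zero_iff, h1]; exact one_ne_zero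
    rw [hW]
    refine ⟨h1, by rw [hJn, h1], ?_, ?_⟩
    · intro h
      have h3 := hJ2 (u x)
      simp only at h
      rw [← h, ← h] at h3
      exact h0 (BU.eq_zero_of_self_neg h3)
    · intro h
      have h3 := hJ2 (u x)
      simp only at h
      have h4 : J (u x) = - u x := (neg_eq_iff_eq_neg.1 h.symm)
      rw [h4, map_neg, h4, neg_neg] at h3
      exact h0 (BU.eq_zero_of_self_neg h3)
  let G : (Fin (d+1) → ℝ) → (Fin d → ℝ) := fun x =>
    if hx : x ≠ 0 then (g ⟨_, huW x hx⟩ : EuclideanSpace ℝ (Fin d)).ofLp else 0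
  have hG : ∀ x (hx : x ≠ 0), G x = (g ⟨_, huW x hx⟩ : EuclideanSpace ℝ (Fin d)).ofLp :=
    fun x hx => dif_pos hx
  refine BU.borsuk_ulam d G ?_ ?_ ?_
  · rw [continuousOn_iff_continuous_domRestrict]
    have hJc : Continuous J := J.continuous_of_finiteDimensional
    have hu : Continuous fun x : {x : Fin (d+1) → ℝ | x ≠ 0} => u x := by
      have h1 : Continuous fun x : {x : Fin (d+1) → ℝ | x ≠ 0} => ι x :=
        hιc.comp continuous_subtype_val
      refine Continuous.smul (h1.norm.inv₀ ?_) h1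
      intro x
      exact norm_ne_zero_iff.2 (hι x x.2)
    have hcont : Continuous fun x : {x : Fin (d+1) → ℝ | x ≠ 0} =>
        (g ⟨_, huW x x.2⟩ : EuclideanSpace ℝ (Fin d)).ofLp := by
      refine (PiLp.continuous_ofLp 2 _).comp (continuous_subtype_val.comp (hgc.comp ?_))
      exact Continuous.subtype_mk (hu.prodMk (hJc.comp hu)) _
    refine hcont.congr ?_
    intro x
    exact (hG x x.2).symm
  · intro x hx
    rw [hG x hx, hG (-x) (neg_ne_zero.2 hx), hgo ⟨_, huW x hx⟩ ⟨_, huW (-x) (neg_ne_zero.2 hx)⟩]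
    · rfl
    · simp [hun]
  · intro x hx h
    rw [hG x hx] at h
    have h1 : (g ⟨_, huW x hx⟩ : EuclideanSpace ℝ (Fin d)) = 0 := by
      ext j; exact congrFun h j
    have h3 := (g ⟨_, huW x hx⟩).2
    rw [h1] at h3
    simp at h3
end

section
/- Let f : S^m → ℝ^d be continuous with m > d, and define F : W₂ → ℝ^d on W₂ = {(p₁,p₂) ∈ S^m × S^m : p₁, p₂ linearly independent} by F(p₁,p₂) = f(p₁) - f(p₂). Then F has a zero, i.e., there exists (p₁,p₂) ∈ W₂ with f(p₁) = f(p₂). -/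
open MeasureTheory Metric Filter Topology

lemma aux_detpoly (n : ℕ) (M : (Fin n → ℝ) → Matrix (Fin n) (Fin n) ℝ)
    (hM : ∀ i j, Continuous fun x => M x i j) (K : Set (Fin n → ℝ)) (hK : IsCompact K) :
    ∃ p : Polynomial ℝ, ∀ t : ℝ, ∫ x in K, (1 + t • M x).det = p.eval t := by
  classical
  refine ⟨∑ σ : Equiv.Perm (Fin n), ∑ S ∈ (Finset.univ : Finset (Fin n)).powerset,
    Polynomial.C (∫ x in K, ((Equiv.Perm.sign σ : ℤ) : ℝ) *
      ((∏ i ∈ S, (1 : Matrix (Fin n) (Fin n) ℝ) (σ i) i) *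
      ∏ i ∈ Finset.univ \ S, M x (σ i) i)) * Polynomial.X ^ (Finset.univ \ S).card, fun t => ?_⟩
  have hc : ∀ (σ : Equiv.Perm (Fin n)) (S : Finset (Fin n)),
      Continuous fun x => ((Equiv.Perm.sign σ : ℤ) : ℝ) *
      ((∏ i ∈ S, (1 : Matrix (Fin n) (Fin n) ℝ) (σ i) i) *
      ∏ i ∈ Finset.univ \ S, M x (σ i) i) := by
    intro σ S
    refine continuous_const.mul (continuous_const.mul ?_)
    exact continuous_finsetProd _ fun i _ => hM _ _
  have h1 : ∀ x, (1 + t • M x).det = ∑ σ : Equiv.Perm (Fin n),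
      ∑ S ∈ (Finset.univ : Finset (Fin n)).powerset,
      (((Equiv.Perm.sign σ : ℤ) : ℝ) *
      ((∏ i ∈ S, (1 : Matrix (Fin n) (Fin n) ℝ) (σ i) i) *
      ∏ i ∈ Finset.univ \ S, M x (σ i) i)) * t ^ (Finset.univ \ S).card := by
    intro x
    rw [Matrix.det_apply']
    refine Finset.sum_congr rfl fun σ _ => ?_
    simp only [Matrix.add_apply, Matrix.smul_apply, smul_eq_mul]
    rw [Finset.prod_add, Finset.mul_sum]
    refine Finset.sum_congr rfl fun S _ => ?_
    rw [Finset.prod_mul_distrib, Finset.prod_const]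
    ring
  simp_rw [h1]
  rw [integral_finsetSum]
  · rw [Polynomial.eval_finsetSum]
    refine Finset.sum_congr rfl fun σ _ => ?_
    rw [integral_finsetSum]
    · rw [Polynomial.eval_finsetSum]
      refine Finset.sum_congr rfl fun S _ => ?_
      rw [integral_mul_const]
      simp
    · intro S _
      exact ((hc σ S).mul continuous_const).continuousOn.integrableOn_compact hK
  · intro σ _
    refine integrable_finsetSum _ fun S _ => ?_
    exact ((hc σ S).mul continuous_const).continuousOn.integrableOn_compact hK

lemma aux_det_matrix (n : ℕ) (A : (Fin n → ℝ) →L[ℝ] (Fin n → ℝ)) (t : ℝ) :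
    (ContinuousLinearMap.id ℝ _ + t • A).det =
      (1 + t • LinearMap.toMatrix' (A : (Fin n → ℝ) →ₗ[ℝ] (Fin n → ℝ))).det := by
  rw [ContinuousLinearMap.det, ← LinearMap.det_toMatrix']
  congr 1
  simp

lemma aux_volume (n : ℕ) (ψ : (Fin n → ℝ) → (Fin n → ℝ)) (hψ : ContDiff ℝ 1 ψ) (R : ℝ)
    (hout : ∀ x, x ∉ closedBall (0 : Fin n → ℝ) R → ψ x = x) :
    ∫ x in closedBall (0 : Fin n → ℝ) R, (fderiv ℝ ψ x).det =
      ∫ x in closedBall (0 : Fin n → ℝ) R, (1 : ℝ) := by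
  set B := closedBall (0 : Fin n → ℝ) R with hB
  have hBc : IsCompact B := isCompact_closedBall 0 R
  set h : (Fin n → ℝ) → (Fin n → ℝ) := fun x => ψ x - x with hh
  have hhc : ContDiff ℝ 1 h := hψ.sub contDiff_id
  have hsupp : HasCompactSupport h := HasCompactSupport.intro hBc fun x hx => by
    simp [hh, hout x hx]
  obtain ⟨L, hL⟩ := ContDiff.lipschitzWith_of_hasCompactSupport (𝕂 := ℝ) hsupp hhc (by simp)
  have hdh : Continuous fun x => fderiv ℝ h x := hhc.continuous_fderiv (by simp)
  have hder : ∀ (t : ℝ) x, HasFDerivAt (fun x => x + t • h x)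
      (ContinuousLinearMap.id ℝ _ + t • fderiv ℝ h x) x := by
    intro t x
    exact (hasFDerivAt_id x).add (((hhc.differentiable (by simp)) x).hasFDerivAt.const_smul t)
  obtain ⟨p, hp⟩ := aux_detpoly n
    (fun x => LinearMap.toMatrix' (fderiv ℝ h x : (Fin n → ℝ) →ₗ[ℝ] (Fin n → ℝ)))
    (by
      intro i j
      simp only [LinearMap.toMatrix'_apply]
      exact (continuous_apply i).comp (hdh.clm_apply continuous_const)) B hBc
  simp_rw [← aux_det_matrix] at hp
  have hcd : Continuous fun q : ℝ × (Fin n → ℝ) =>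
      (ContinuousLinearMap.id ℝ _ + q.1 • fderiv ℝ h q.2).det := by
    refine ContinuousLinearMap.continuous_det.comp ?_
    exact continuous_const.add (continuous_fst.smul (hdh.comp continuous_snd))
  have hpos : ∀ᶠ t in 𝓝 (0 : ℝ), ∀ x ∈ B,
      0 < (ContinuousLinearMap.id ℝ _ + t • fderiv ℝ h x).det := by
    refine hBc.eventually_forall_of_forall_eventually fun x _ => ?_
    have : 0 < (ContinuousLinearMap.id ℝ _ + (0 : ℝ) • fderiv ℝ h x).det := by
      simp [ContinuousLinearMap.det]
    exact (hcd.tendsto (0, x)).eventually (lt_mem_nhds this)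
  have hsmall : ∀ᶠ t in 𝓝 (0 : ℝ), ‖t‖₊ * L < 1 := by
    have : Tendsto (fun t : ℝ => ‖t‖₊ * L) (𝓝 0) (𝓝 (‖(0 : ℝ)‖₊ * L)) :=
      (continuous_nnnorm.mul continuous_const).tendsto 0
    exact this.eventually (gt_mem_nhds (by simp))
  have key : ∀ᶠ t in 𝓝 (0 : ℝ), p.eval t = (Polynomial.C (∫ x in B, (1 : ℝ))).eval t := by
    filter_upwards [hpos, hsmall] with t ht1 ht2
    have happ : ApproximatesLinearOn (fun x => x + t • h x)
        ((ContinuousLinearEquiv.refl ℝ (Fin n → ℝ)) : (Fin n → ℝ) →L[ℝ] (Fin n → ℝ))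
        Set.univ (‖t‖₊ * L) := by
      intro x _ y _
      have := hL.dist_le_mul x y
      rw [dist_eq_norm, dist_eq_norm] at this
      have e : x + t • h x - (y + t • h y) -
        ((ContinuousLinearEquiv.refl ℝ (Fin n → ℝ)) : (Fin n → ℝ) →L[ℝ] (Fin n → ℝ)) (x - y)
          = t • (h x - h y) := by
        simp [smul_sub]; abel
      rw [e, norm_smul]
      simp only [NNReal.coe_mul, coe_nnnorm, mul_assoc]
      gcongr
    have hc : Subsingleton (Fin n → ℝ) ∨ ‖t‖₊ * L <
        ‖((ContinuousLinearEquiv.refl ℝ (Fin n → ℝ)).symm :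
          (Fin n → ℝ) →L[ℝ] (Fin n → ℝ))‖₊⁻¹ := by
      rcases subsingleton_or_nontrivial (Fin n → ℝ) with hs | hs
      · exact Or.inl hs
      · right
        have : ‖((ContinuousLinearEquiv.refl ℝ (Fin n → ℝ)).symm :
          (Fin n → ℝ) →L[ℝ] (Fin n → ℝ))‖₊ = 1 := by
          have := ContinuousLinearMap.norm_id (𝕜 := ℝ) (E := Fin n → ℝ)
          exact NNReal.eq this
        rw [this]; simpa using ht2
    have hinj : Function.Injective (fun x => x + t • h x) :=
      Set.injOn_univ.mp (happ.injOn hc)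
    have hsurj := happ.surjective hc
    have hout' : ∀ x, x ∉ B → x + t • h x = x := by
      intro x hx; simp [hh, hout x hx]
    have himg : (fun x => x + t • h x) '' B = B := by
      apply Set.Subset.antisymm
      · rintro _ ⟨x, hx, rfl⟩
        by_contra hcon
        have := hout' _ hcon
        have h2 := hinj this
        exact hcon (by simp only at h2 ⊢; rw [h2]; exact hx)
      · intro y hy
        obtain ⟨x, rfl⟩ := hsurj y
        refine ⟨x, ?_, rfl⟩
        by_contra hx
        simp only [hout' x hx] at hy
        exact hx hy
    have hcv := integral_image_eq_integral_abs_det_fderiv_smul volume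
      hBc.measurableSet (fun x _ => (hder t x).hasFDerivWithinAt (s := B)) hinj.injOn
      (fun _ => (1 : ℝ))
    rw [himg] at hcv
    rw [← hp, Polynomial.eval_C, hcv]
    refine setIntegral_congr_fun hBc.measurableSet fun x hx => ?_
    simp [abs_of_pos (ht1 x hx)]
  have hpe : p = Polynomial.C (∫ x in B, (1 : ℝ)) :=
    Polynomial.eq_of_infinite_eval_eq _ _ (infinite_of_mem_nhds 0 key)
  have h1 := hp 1
  rw [hpe, Polynomial.eval_C] at h1
  rw [← h1]
  refine setIntegral_congr_fun hBc.measurableSet fun x hx => ?_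
  have : HasFDerivAt ψ (ContinuousLinearMap.id ℝ _ + (1 : ℝ) • fderiv ℝ h x) x := by
    have := hder 1 x
    convert this using 1
    ext x; simp [hh]
  simp only [this.fderiv]

lemma aux_null (n : ℕ) (u v : (Fin n → ℝ) → (Fin n → ℝ)) (hu : ContDiff ℝ 1 u)
    (hv : ContDiff ℝ 1 v) (R : ℝ) (hR : 0 < R)
    (hout : ∀ x, x ∉ closedBall (0 : Fin n → ℝ) R → u x = v x) :
    ∫ x in closedBall (0 : Fin n → ℝ) R, (fderiv ℝ u x).det =
      ∫ x in closedBall (0 : Fin n → ℝ) R, (fderiv ℝ v x).det := by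
  let χ : ContDiffBump (0 : Fin n → ℝ) := ⟨R + 1, R + 2, by linarith, by linarith⟩
  let T : ((Fin n → ℝ) → (Fin n → ℝ)) → (Fin n → ℝ) → (Fin n → ℝ) :=
    fun w x => x + χ x • (w x - x)
  have hT : ∀ w : (Fin n → ℝ) → (Fin n → ℝ), ContDiff ℝ 1 w → ContDiff ℝ 1 (T w) := fun w hw =>
    contDiff_id.add (χ.contDiff.smul (hw.sub contDiff_id))
  have hTv : ∀ w : (Fin n → ℝ) → (Fin n → ℝ), ContDiff ℝ 1 w → ∫ x in closedBall (0 : Fin n → ℝ) (R + 2),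
      (fderiv ℝ (T w) x).det = ∫ x in closedBall (0 : Fin n → ℝ) (R + 2), (1 : ℝ) := by
    intro w hw
    refine aux_volume n (T w) (hT w hw) (R + 2) fun x hx => ?_
    have : χ x = 0 := χ.zero_of_le_dist (by
      rw [mem_closedBall, not_le] at hx; exact hx.le)
    simp [T, this]
  have hTin : ∀ w x, x ∈ closedBall (0 : Fin n → ℝ) R → fderiv ℝ (T w) x = fderiv ℝ w x := by
    intro w x hx
    refine Filter.EventuallyEq.fderiv_eq ?_
    have hx' : x ∈ ball (0 : Fin n → ℝ) χ.rIn := by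
      rw [mem_closedBall] at hx; rw [mem_ball]
      change dist x 0 < R + 1
      linarith
    filter_upwards [χ.eventuallyEq_one_of_mem_ball hx'] with y hy
    simp [T, hy]
  have hTout : ∀ x, x ∉ closedBall (0 : Fin n → ℝ) R →
      fderiv ℝ (T u) x = fderiv ℝ (T v) x := by
    intro x hx
    refine Filter.EventuallyEq.fderiv_eq ?_
    filter_upwards [isClosed_closedBall.isOpen_compl.mem_nhds hx] with y hy
    simp [T, hout y hy]
  have hcont : ∀ w : (Fin n → ℝ) → (Fin n → ℝ), ContDiff ℝ 1 w → Continuous fun x => (fderiv ℝ w x).det := fun w hw =>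
    ContinuousLinearMap.continuous_det.comp (hw.continuous_fderiv (by simp))
  have hint : ∀ w : (Fin n → ℝ) → (Fin n → ℝ), ContDiff ℝ 1 w → ∀ r : ℝ, IntegrableOn (fun x => (fderiv ℝ w x).det)
      (closedBall (0 : Fin n → ℝ) r) := fun w hw r =>
    (hcont w hw).continuousOn.integrableOn_compact (isCompact_closedBall 0 r)
  have e1 : ∫ x in closedBall (0 : Fin n → ℝ) (R + 2),
      ((fderiv ℝ (T u) x).det - (fderiv ℝ (T v) x).det) = 0 := by
    rw [integral_sub (hint _ (hT u hu) _) (hint _ (hT v hv) _), hTv u hu, hTv v hv, sub_self]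
  have e2 : ∫ x in closedBall (0 : Fin n → ℝ) (R + 2),
      ((fderiv ℝ (T u) x).det - (fderiv ℝ (T v) x).det) =
      ∫ x in closedBall (0 : Fin n → ℝ) R,
      ((fderiv ℝ (T u) x).det - (fderiv ℝ (T v) x).det) := by
    refine setIntegral_eq_of_subset_of_forall_sdiff_eq_zero measurableSet_closedBall
      (closedBall_subset_closedBall (by linarith)) fun x hx => ?_
    rw [hTout x hx.2, sub_self]
  have e3 : ∫ x in closedBall (0 : Fin n → ℝ) R,
      ((fderiv ℝ (T u) x).det - (fderiv ℝ (T v) x).det) =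
      ∫ x in closedBall (0 : Fin n → ℝ) R,
      ((fderiv ℝ u x).det - (fderiv ℝ v x).det) := by
    refine setIntegral_congr_fun measurableSet_closedBall fun x hx => ?_
    simp only [hTin u x hx, hTin v x hx]
  rw [e3, integral_sub (hint u hu R) (hint v hv R)] at e2
  linarith

lemma aux_approx {X : Type*} [TopologicalSpace X] [CompactSpace X] (k l : ℕ)
    (e : X → (Fin k → ℝ)) (he : Continuous e) (hinj : Function.Injective e)
    (φ : X → (Fin l → ℝ)) (hφ : Continuous φ) (ε : ℝ) (hε : 0 < ε) :
    ∃ G : (Fin k → ℝ) → (Fin l → ℝ), ContDiff ℝ 1 G ∧ ∀ x, dist (G (e x)) (φ x) < ε := by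
  let A : Subalgebra ℝ C(X, ℝ) :=
    { carrier := {a | ∃ G : (Fin k → ℝ) → ℝ, ContDiff ℝ 1 G ∧ ∀ x, a x = G (e x)}
      mul_mem' := by
        rintro a b ⟨G, hG, h1⟩ ⟨G', hG', h2⟩
        exact ⟨fun y => G y * G' y, hG.mul hG', fun x => by simp [h1, h2]⟩
      add_mem' := by
        rintro a b ⟨G, hG, h1⟩ ⟨G', hG', h2⟩
        exact ⟨fun y => G y + G' y, hG.add hG', fun x => by simp [h1, h2]⟩
      algebraMap_mem' := by
        intro r
        exact ⟨fun _ => r, contDiff_const, fun x => by simp⟩ }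
  have hA : A.SeparatesPoints := by
    intro x y hxy
    have : e x ≠ e y := fun h => hxy (hinj h)
    obtain ⟨i, hi⟩ := Function.ne_iff.mp this
    exact ⟨fun z => e z i, ⟨⟨fun z => e z i, (continuous_apply i).comp he⟩,
      ⟨fun y => y i, contDiff_apply ℝ ℝ i, fun _ => rfl⟩, rfl⟩, hi⟩
  have : ∀ i : Fin l, ∃ G : (Fin k → ℝ) → ℝ, ContDiff ℝ 1 G ∧
      ∀ x, ‖G (e x) - φ x i‖ < ε := by
    intro i
    obtain ⟨⟨a, G, hG, h1⟩, h2⟩ :=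
      ContinuousMap.exists_mem_subalgebra_near_continuous_of_separatesPoints A hA
        (fun x => φ x i) ((continuous_apply i).comp hφ) ε hε
    refine ⟨G, hG, fun x => ?_⟩
    rw [← h1]; exact h2 x
  choose G hG h using this
  refine ⟨fun y i => G i y, contDiff_pi.2 hG, fun x => ?_⟩
  rw [dist_pi_lt_iff hε]
  intro i
  rw [Real.dist_eq]
  exact h i x

lemma aux_deriv_zero (y : ℝ) (hy : 1 < |y|) : deriv Real.smoothTransition y = 0 := by
  rcases lt_abs.mp hy with h | h
  · have : Real.smoothTransition =ᶠ[𝓝 y] fun _ => (1 : ℝ) := by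
      filter_upwards [lt_mem_nhds h] with z hz
      exact Real.smoothTransition.one_of_one_le hz.le
    rw [this.deriv_eq]; simp
  · have : Real.smoothTransition =ᶠ[𝓝 y] fun _ => (0 : ℝ) := by
      filter_upwards [gt_mem_nhds (show y < 0 by linarith)] with z hz
      exact Real.smoothTransition.zero_of_nonpos hz.le
    rw [this.deriv_eq]; simp

lemma aux_H (n : ℕ) (z : Fin n → ℝ) :
    (fderiv ℝ (fun (z : Fin n → ℝ) i => Real.smoothTransition (z i)) z).det =
      ∏ i, deriv Real.smoothTransition (z i) := by
  have h1 : HasFDerivAt (fun (z : Fin n → ℝ) i => Real.smoothTransition (z i))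
      (ContinuousLinearMap.pi fun i => (deriv Real.smoothTransition (z i)) •
        (ContinuousLinearMap.proj (R := ℝ) (φ := fun _ : Fin n => ℝ) i)) z := by
    rw [hasFDerivAt_pi]
    intro i
    have hd : HasDerivAt Real.smoothTransition (deriv Real.smoothTransition (z i)) (z i) :=
      ((Real.smoothTransition.contDiff (n := 1)).differentiable (by simp) _).hasDerivAt
    have hp : HasFDerivAt (fun y : Fin n → ℝ => y i)
        (ContinuousLinearMap.proj (R := ℝ) (φ := fun _ : Fin n => ℝ) i) z :=
      (ContinuousLinearMap.proj (R := ℝ) (φ := fun _ : Fin n => ℝ) i).hasFDerivAt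
    exact hd.comp_hasFDerivAt z hp
  rw [h1.fderiv, ContinuousLinearMap.det, ← LinearMap.det_toMatrix', ← Matrix.det_diagonal]
  congr 1
  ext i j
  simp [LinearMap.toMatrix'_apply, Matrix.diagonal_apply, Pi.single_apply]

lemma aux_H_zero (n : ℕ) (z : Fin n → ℝ) (hz : 1 < ‖z‖) :
    ∏ i, deriv Real.smoothTransition (z i) = 0 := by
  by_contra hne
  have : ‖z‖ ≤ 1 := by
    rw [pi_norm_le_iff_of_nonneg zero_le_one]
    intro i
    by_contra hi
    rw [not_le, Real.norm_eq_abs] at hi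
    exact hne (Finset.prod_eq_zero (Finset.mem_univ i) (aux_deriv_zero _ hi))
  linarith

lemma aux_H_pos (n : ℕ) : 0 < ∫ z in closedBall (0 : Fin n → ℝ) 3,
    (fderiv ℝ (fun (z : Fin n → ℝ) i => Real.smoothTransition (z i)) z).det := by
  simp_rw [aux_H]
  have hz : ∀ z : Fin n → ℝ, z ∉ closedBall (0 : Fin n → ℝ) 3 →
      ∏ i, deriv Real.smoothTransition (z i) = 0 := by
    intro z hz
    rw [mem_closedBall_zero_iff, not_le] at hz
    exact aux_H_zero n z (by linarith)
  rw [setIntegral_eq_integral_of_forall_compl_eq_zero hz]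
  have hs := Real.smoothTransition.contDiff (n := 1)
  obtain ⟨c, -, hc⟩ := exists_deriv_eq_slope Real.smoothTransition (zero_lt_one' ℝ)
    hs.continuous.continuousOn ((hs.differentiable (by simp)).differentiableOn)
  have hc' : deriv Real.smoothTransition c = 1 := by rw [hc]; simp
  refine Continuous.integral_pos_of_hasCompactSupport_nonneg_nonzero (x := fun _ => c) ?_ ?_ ?_ ?_
  · refine continuous_finsetProd _ fun i _ => ?_
    exact (hs.continuous_deriv (by simp)).comp (continuous_apply i)
  · exact HasCompactSupport.intro (isCompact_closedBall 0 3) hz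
  · intro z
    exact Finset.prod_nonneg fun i _ => Real.smoothTransition.monotone.deriv_nonneg
  · simp [hc']

/-- There is no continuous injection from `ℝ^n` to `ℝ^d` when `d < n`. -/
lemma aux_no_inj (n d : ℕ) (hnd : d < n) (f : (Fin n → ℝ) → (Fin d → ℝ))
    (hf : Continuous f) (hinj : Function.Injective f) : False := by
  set B := closedBall (0 : Fin n → ℝ) 3 with hB
  have hBc : IsCompact B := isCompact_closedBall 0 3
  have : CompactSpace B := isCompact_iff_compactSpace.mp hBc
  obtain ⟨g, hg, hg1⟩ := aux_approx (X := B) d n (fun x => f x)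
    (hf.comp continuous_subtype_val) (hinj.comp Subtype.val_injective)
    (fun x => x) continuous_subtype_val (1 / 2) (by norm_num)
  have huc := (hBc.image hf).uniformContinuousAt_of_continuousAt g
    (fun a _ => hg.continuous.continuousAt) (Metric.dist_mem_uniformity (ε := 1 / 2) (by norm_num))
  obtain ⟨δ, hδ, hδ'⟩ := Metric.mem_uniformity_dist.mp huc
  obtain ⟨f', hf', hf1⟩ := aux_approx (X := B) n d (fun x => x)
    continuous_subtype_val Subtype.val_injective (fun x => f x)
    (hf.comp continuous_subtype_val) δ hδ
  have hclose : ∀ x ∈ B, ‖g (f' x) - x‖ < 1 := by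
    intro x hx
    have h1 := hg1 ⟨x, hx⟩
    have h2 := hf1 ⟨x, hx⟩
    rw [dist_comm] at h2
    have h3 : dist (g (f x)) (g (f' x)) < 1 / 2 := hδ' h2 ⟨x, hx, rfl⟩
    rw [← dist_eq_norm]
    have := dist_triangle_left (g (f' x)) x (g (f x))
    simp only at h1
    linarith
  let χ : ContDiffBump (0 : Fin n → ℝ) := ⟨2, 3, by norm_num, by norm_num⟩
  let ψ : (Fin n → ℝ) → (Fin n → ℝ) := fun x => x + χ x • (g (f' x) - x)
  have hψ : ContDiff ℝ 1 ψ :=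
    contDiff_id.add (χ.contDiff.smul ((hg.comp hf').sub contDiff_id))
  let H : (Fin n → ℝ) → (Fin n → ℝ) := fun z i => Real.smoothTransition (z i)
  have hH : ContDiff ℝ 1 H := contDiff_pi.2 fun i =>
    Real.smoothTransition.contDiff.comp (contDiff_apply ℝ ℝ i)
  have hout : ∀ x, x ∉ closedBall (0 : Fin n → ℝ) 3 → (H ∘ ψ) x = H x := by
    intro x hx
    have : χ x = 0 := χ.zero_of_le_dist (by
      rw [mem_closedBall, not_le] at hx; exact hx.le)
    simp [ψ, this]
  have hnull := aux_null n (H ∘ ψ) H (hH.comp hψ) hH 3 (by norm_num) hout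
  have hpos := aux_H_pos n
  have hzero : ∫ x in closedBall (0 : Fin n → ℝ) 3, (fderiv ℝ (H ∘ ψ) x).det = 0 := by
    refine setIntegral_eq_zero_of_forall_eq_zero fun x hx => ?_
    rw [fderiv_comp x (hH.differentiable (by simp) _) (hψ.differentiable (by simp) _)]
    have hmul : ((fderiv ℝ H (ψ x)).comp (fderiv ℝ ψ x)).det =
        (fderiv ℝ H (ψ x)).det * (fderiv ℝ ψ x).det := by
      exact LinearMap.det_comp _ _
    rw [hmul]
    by_cases hx2 : ‖x‖ < 2
    · have hx' : x ∈ ball (0 : Fin n → ℝ) χ.rIn := by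
        rw [mem_ball_zero_iff]; exact hx2
      have he : ψ =ᶠ[𝓝 x] g ∘ f' := by
        filter_upwards [χ.eventuallyEq_one_of_mem_ball hx'] with y hy
        simp [ψ, hy]
      rw [he.fderiv_eq, fderiv_comp x (hg.differentiable (by simp) _)
        (hf'.differentiable (by simp) _)]
      have : ((fderiv ℝ g (f' x)).comp (fderiv ℝ f' x)).det = 0 := by
        rw [ContinuousLinearMap.det, LinearMap.det_eq_zero_iff_ker_ne_bot]
        have hk : LinearMap.ker (fderiv ℝ f' x : (Fin n → ℝ) →ₗ[ℝ] (Fin d → ℝ)) ≠ ⊥ :=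
          LinearMap.ker_ne_bot_of_finrank_lt (by simpa using hnd)
        intro hb
        apply hk
        rw [eq_bot_iff, ← hb]
        intro v hv
        rw [LinearMap.mem_ker] at hv ⊢
        change fderiv ℝ f' x v = 0 at hv
        change fderiv ℝ g (f' x) (fderiv ℝ f' x v) = 0
        rw [hv, map_zero]
      rw [this, mul_zero]
    · have : 1 < ‖ψ x‖ := by
        have h1 := hclose x hx
        have h2 : ‖χ x • (g (f' x) - x)‖ ≤ 1 * ‖g (f' x) - x‖ := by
          rw [norm_smul, Real.norm_of_nonneg χ.nonneg]
          gcongr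
          exact χ.le_one
        have h3 : ‖x‖ ≤ ‖ψ x‖ + ‖χ x • (g (f' x) - x)‖ := by
          have : x = ψ x - χ x • (g (f' x) - x) := by simp [ψ]
          calc ‖x‖ = ‖ψ x - χ x • (g (f' x) - x)‖ := by rw [← this]
            _ ≤ _ := norm_sub_le _ _
        push Not at hx2
        linarith
      have h0 : (fderiv ℝ H (ψ x)).det = 0 := by
        rw [aux_H n (ψ x), aux_H_zero n _ this]
      rw [h0, zero_mul]
  rw [hzero] at hnull
  exact hpos.ne hnull

theorem stmt_15 (m d : ℕ) (hmd : m > d)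
    (f : Metric.sphere (0 : EuclideanSpace ℝ (Fin (m+1))) 1 → EuclideanSpace ℝ (Fin d))
    (hf : Continuous f) :
    ∃ p₁ p₂ : Metric.sphere (0 : EuclideanSpace ℝ (Fin (m+1))) 1,
      LinearIndependent ℝ
        ![(p₁ : EuclideanSpace ℝ (Fin (m+1))), (p₂ : EuclideanSpace ℝ (Fin (m+1)))] ∧
      f p₁ - f p₂ = 0 := by
  let w : (Fin m → ℝ) → EuclideanSpace ℝ (Fin (m+1)) := fun x =>
    WithLp.toLp 2 (Fin.cons 1 x : Fin (m+1) → ℝ)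
  have hw0 : ∀ x, w x 0 = 1 := fun x => rfl
  have hws : ∀ x i, w x (Fin.succ i) = x i := fun x i => rfl
  have hwne : ∀ x, w x ≠ 0 := by
    intro x hx
    have := hw0 x
    rw [hx] at this
    simp at this
  have hwc : Continuous w := by
    refine (PiLp.continuous_toLp 2 _).comp ?_
    refine continuous_pi fun i => ?_
    refine Fin.cases ?_ (fun j => ?_) i
    · simpa using continuous_const
    · simpa using continuous_apply j
  let e : (Fin m → ℝ) → Metric.sphere (0 : EuclideanSpace ℝ (Fin (m+1))) 1 := fun x =>
    ⟨(‖w x‖)⁻¹ • w x, by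
      rw [mem_sphere_zero_iff_norm, norm_smul, norm_inv, norm_norm,
        inv_mul_cancel₀ (norm_ne_zero_iff.2 (hwne x))]⟩
  have hec : Continuous e := by
    refine Continuous.subtype_mk ?_ _
    exact (hwc.norm.inv₀ fun x => norm_ne_zero_iff.2 (hwne x)).smul hwc
  by_contra hcon
  push Not at hcon
  refine aux_no_inj m d hmd (fun x => WithLp.ofLp (f (e x)))
    ((PiLp.continuous_ofLp 2 _).comp (hf.comp hec)) ?_
  intro x y hxy
  by_contra hne
  have hfe : f (e x) = f (e y) := (WithLp.ofLp_injective 2) hxy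
  refine hcon (e x) (e y) ?_ (by rw [hfe, sub_self])
  rw [LinearIndependent.pair_iff]
  intro a b hab
  have ha : (‖w x‖)⁻¹ ≠ 0 := inv_ne_zero (norm_ne_zero_iff.2 (hwne x))
  have hb : (‖w y‖)⁻¹ ≠ 0 := inv_ne_zero (norm_ne_zero_iff.2 (hwne y))
  have hcoord : ∀ i, a * ((‖w x‖)⁻¹ * w x i) + b * ((‖w y‖)⁻¹ * w y i) = 0 := by
    intro i
    have := congrArg (fun v : EuclideanSpace ℝ (Fin (m+1)) => v i) hab
    simpa [e] using this
  generalize (‖w x‖)⁻¹ = p at *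
  generalize (‖w y‖)⁻¹ = q at *
  obtain ⟨i, hi⟩ := Function.ne_iff.mp hne
  have h0 := hcoord 0
  have h1 := hcoord i.succ
  rw [hw0, hw0] at h0
  rw [hws, hws] at h1
  have h2 : (a * p) * (x i - y i) = 0 := by linear_combination h1 - y i * h0
  have h3 : a = 0 := by
    rcases mul_eq_zero.mp h2 with h | h
    · exact (mul_eq_zero.mp h).resolve_right ha
    · exact absurd (sub_eq_zero.mp h) hi
  subst h3
  refine ⟨rfl, ?_⟩
  have h4 : b * q = 0 := by linear_combination h0
  exact (mul_eq_zero.mp h4).resolve_right hb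
end
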